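/- Let K be a field of characteristic 0, σ : K → K a field automorphism, L an algebraic field extension of K, and τ : L → L a field automorphism extending σ (i.e. τ(ι(x)) = ι(σ(x)) for all x ∈ K, where ι : K → L is the embedding). Let e ∈ K with e ≠ 0. If for every integer z ≠ 0 the equation σ(x) = e^z·x has no solution x ∈ K ∖ {0}, then for every integer z ≠ 0 the equation τ(x) = ι(e)^z·x has no solution x ∈ L ∖ {0}. -/

import Mathlib

open Polynomial in
/-- Minimal polynomials are transported by a ring automorphism extending one of the base field. -/
theorem minpoly_map_ringEquiv {K L : Type*} [Field K] [Field L] [Algebra K L]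
    (σ : K ≃+* K) (τ : L ≃+* L)
    (hτσ : ∀ x : K, τ (algebraMap K L x) = algebraMap K L (σ x))
    {x : L} (hx : IsIntegral K x) :
    minpoly K (τ x) = (minpoly K x).map (σ : K →+* K) := by
  symm
  refine minpoly.eq_of_irreducible_of_monic ?_ ?_ ((minpoly.monic hx).map _)
  · exact (MulEquiv.irreducible_iff (mapEquiv σ)).mpr (minpoly.irreducible hx)
  · have hcomp : (algebraMap K L).comp (σ : K →+* K) = (τ : L →+* L).comp (algebraMap K L) :=
      RingHom.ext fun y => (hτσ y).symm
    have h := hom_eval₂ (minpoly K x) (algebraMap K L) (τ : L →+* L) x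
    rw [← aeval_def, minpoly.aeval, map_zero] at h
    rw [aeval_def, eval₂_map, hcomp]
    exact h.symm

open Polynomial in
/-- Scaling an element by a nonzero scalar scales the roots of its minimal polynomial. -/
theorem minpoly_algebraMap_mul {K L : Type*} [Field K] [Field L] [Algebra K L]
    {c : K} (hc : c ≠ 0) {x : L} (hx : IsIntegral K x) :
    minpoly K (algebraMap K L c * x) = (minpoly K x).scaleRoots c := by
  symm
  refine minpoly.unique K _ ((monic_scaleRoots_iff c).mpr (minpoly.monic hx))
    (scaleRoots_aeval_eq_zero (minpoly.aeval K x)) fun q hq hqx => ?_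
  have hroot : aeval x (q.scaleRoots c⁻¹) = 0 := by
    have h := scaleRoots_aeval_eq_zero (r := c⁻¹) hqx
    rwa [← mul_assoc, ← map_mul, inv_mul_cancel₀ hc, map_one, one_mul] at h
  simpa only [degree_scaleRoots] using
    minpoly.min K x ((monic_scaleRoots_iff c⁻¹).mpr hq) hroot

/-- If for every nonzero integer `z` the multiplicative equation `σ(x) = e^z·x`
(with `e ≠ 0`) has no nonzero solution in a characteristic-zero field `K`, then
for every nonzero integer `z` it has no nonzero solution in any algebraic
extension `L` of `K` (with respect to any automorphism `τ` of `L` extending `σ`). -/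
theorem multiplicative_equation_not_solvable_in_algebraic_extension
    {K L : Type*} [Field K] [Field L] [CharZero K]
    [Algebra K L] [Algebra.IsAlgebraic K L]
    (σ : K ≃+* K) (τ : L ≃+* L)
    (hτσ : ∀ x : K, τ (algebraMap K L x) = algebraMap K L (σ x))
    (e : K) (he : e ≠ 0)
    (hK : ∀ z : ℤ, z ≠ 0 → ¬ ∃ x : K, x ≠ 0 ∧ σ x = e ^ z * x) :
    ∀ z : ℤ, z ≠ 0 → ¬ ∃ x : L, x ≠ 0 ∧ τ x = (algebraMap K L e) ^ z * x := by
  rintro z hz ⟨x, hx, hτx⟩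
  have hint : IsIntegral K x := Algebra.IsIntegral.isIntegral x
  have hn : (minpoly K x).natDegree ≠ 0 := (minpoly.natDegree_pos hint).ne'
  refine hK (z * (minpoly K x).natDegree) (mul_ne_zero hz (by exact_mod_cast hn))
    ⟨(minpoly K x).coeff 0, minpoly.coeff_zero_ne_zero hint hx, ?_⟩
  have hc : τ x = algebraMap K L (e ^ z) * x := by rw [hτx, map_zpow₀]
  have hmap := minpoly_map_ringEquiv σ τ hτσ hint
  rw [hc, minpoly_algebraMap_mul (zpow_ne_zero z he) hint] at hmap
  have hcoeff := congrArg (fun p => p.coeff 0) hmap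
  simp only [Polynomial.coeff_scaleRoots, Polynomial.coeff_map, Nat.sub_zero] at hcoeff
  rw [zpow_mul, zpow_natCast, mul_comm]
  exact hcoeff.symm
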